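/- arXiv:2601.09175 — 4 statements merged into one kernel-verified Lean document; each statement's English description precedes it below -/
import Mathlib

section
/- Let n ≥ 1 and 1 ≤ q ≤ p < ∞. There is a constant C > 0, depending only on n and p, with the following property: for every g ∈ BMO(ℝ^n), every k ∈ ℕ ∪ {0}, all real numbers α ≥ β > 0, and every y ∈ B(0,β), one has ‖χ_{B(0,2^{k+1}α) \ B(0,2^k α)} · |g − g(y)|‖_{M^p_q} ≤ C (2^k α)^{n/p} ( ‖g‖_* · log₂(2^{k+1} α / β) + |g(y) − m_{B(0,β)}(g)| ). -/
open MeasureTheory Metric ENNReal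

noncomputable section

/-- Euclidean space ℝⁿ. -/
abbrev Eucl (n : ℕ) := EuclideanSpace ℝ (Fin n)

/-- The Morrey norm ‖f‖_{M^p_q}. -/
noncomputable def morreyNorm (n : ℕ) (p q : ℝ) (f : Eucl n → ℝ) : ℝ≥0∞ :=
  ⨆ (x : Eucl n) (r : ℝ) (_ : 0 < r),
    (volume (ball x r)) ^ (1 / p - 1 / q) *
      (∫⁻ y in ball x r, ENNReal.ofReal (|f y| ^ q)) ^ (1 / q)

/-- Membership in the Morrey space M^p_q(ℝⁿ). -/
def MemMorrey (n : ℕ) (p q : ℝ) (f : Eucl n → ℝ) : Prop :=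
  Measurable f ∧ morreyNorm n p q f < ⊤

/-- Average of `b` over the ball `B(x,r)`. -/
noncomputable def ballAvg (n : ℕ) (b : Eucl n → ℝ) (x : Eucl n) (r : ℝ) : ℝ :=
  ⨍ y in ball x r, b y

/-- The BMO norm ‖b‖_*. -/
noncomputable def bmoNorm (n : ℕ) (b : Eucl n → ℝ) : ℝ≥0∞ :=
  ⨆ (x : Eucl n) (r : ℝ) (_ : 0 < r),
    (volume (ball x r))⁻¹ *
      ∫⁻ y in ball x r, ENNReal.ofReal |b y - ballAvg n b x r|

/-- Membership in BMO(ℝⁿ). -/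
def MemBMO (n : ℕ) (b : Eucl n → ℝ) : Prop :=
  LocallyIntegrable b volume ∧ bmoNorm n b < ⊤

/-- Smooth compactly supported functions (the class C_c^∞). -/
def IsCcSmooth (n : ℕ) (φ : Eucl n → ℝ) : Prop :=
  ContDiff ℝ (⊤ : ℕ∞) φ ∧ HasCompactSupport φ

/-- VMO(ℝⁿ): the closure of C_c^∞ in the BMO norm. -/
def MemVMO (n : ℕ) (b : Eucl n → ℝ) : Prop :=
  MemBMO n b ∧ ∀ ε : ℝ, 0 < ε → ∃ φ : Eucl n → ℝ, IsCcSmooth n φ ∧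
    bmoNorm n (fun x => b x - φ x) < ENNReal.ofReal ε

/-- The tilde subspace: closure of C_c^∞ in the Morrey norm. -/
def MemTildeMorrey (n : ℕ) (p q : ℝ) (f : Eucl n → ℝ) : Prop :=
  MemMorrey n p q f ∧ ∀ ε : ℝ, 0 < ε → ∃ φ : Eucl n → ℝ, IsCcSmooth n φ ∧
    morreyNorm n p q (fun x => f x - φ x) < ENNReal.ofReal ε

/-- The bar subspace: closure of L^∞ ∩ M^p_q in the Morrey norm. -/
def MemBarMorrey (n : ℕ) (p q : ℝ) (f : Eucl n → ℝ) : Prop :=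
  MemMorrey n p q f ∧ ∀ ε : ℝ, 0 < ε → ∃ g : Eucl n → ℝ, MemMorrey n p q g ∧
    (∃ C : ℝ, ∀ᵐ x ∂(volume : Measure (Eucl n)), |g x| ≤ C) ∧
    morreyNorm n p q (fun x => f x - g x) < ENNReal.ofReal ε

/-- The star subspace: closure of the compactly supported members of M^p_q. -/
def MemStarMorrey (n : ℕ) (p q : ℝ) (f : Eucl n → ℝ) : Prop :=
  MemMorrey n p q f ∧ ∀ ε : ℝ, 0 < ε → ∃ g : Eucl n → ℝ, MemMorrey n p q g ∧
    HasCompactSupport g ∧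
    morreyNorm n p q (fun x => f x - g x) < ENNReal.ofReal ε

/-- The fractional integral operator I_α. -/
noncomputable def fracInt (n : ℕ) (α : ℝ) (f : Eucl n → ℝ) (x : Eucl n) : ℝ :=
  ∫ y, f y * dist x y ^ (α - (n : ℝ))

/-- The multilinear commutator [a_{{1,…,l}}, I_α]. -/
noncomputable def mlCommutator (n l : ℕ) (α : ℝ) (a : Fin l → Eucl n → ℝ)
    (f : Eucl n → ℝ) (x : Eucl n) : ℝ :=
  ∫ y, (∏ j, (a j x - a j y)) * f y * dist x y ^ (α - (n : ℝ))

end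

section Oscillation

open Set Filter Topology

variable {n : ℕ} {g : Eucl n → ℝ} {M : ℝ≥0∞}

lemma volume_ball_two_pow_mul (x y : Eucl n) {r : ℝ} (hr : 0 < r) (j : ℕ) :
    volume (ball x (2 ^ j * r)) = (2 ^ n) ^ j * volume (ball y r) := by
  rw [Measure.addHaar_ball_of_pos volume x (by positivity : 0 < 2 ^ j * r),
    Measure.addHaar_ball_of_pos volume y hr, ← mul_assoc, finrank_euclideanSpace_fin, mul_pow,
    ENNReal.ofReal_mul (by positivity), ← pow_mul, ENNReal.ofReal_pow (by positivity),
    ENNReal.ofReal_ofNat, ← pow_mul, mul_comm j n]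

lemma volume_ball_two_mul (x y : Eucl n) {r : ℝ} (hr : 0 < r) :
    volume (ball x (2 * r)) = 2 ^ n * volume (ball y r) := by
  simpa using volume_ball_two_pow_mul x y hr 1

lemma volume_ball_ne_zero (x : Eucl n) {r : ℝ} (hr : 0 < r) : volume (ball x r) ≠ 0 :=
  (measure_ball_pos volume x hr).ne'

lemma volume_ball_ne_top (x : Eucl n) (r : ℝ) : volume (ball x r) ≠ ⊤ :=
  measure_ball_lt_top.ne

lemma integrableOn_ball_of_locallyIntegrable (hg : LocallyIntegrable g volume) (x : Eucl n)
    (r : ℝ) : IntegrableOn g (ball x r) :=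
  (hg.integrableOn_isCompact (isCompact_closedBall x r)).mono_set ball_subset_closedBall

/-- The distance from a ball average to a constant is at most the mean distance. -/
lemma enorm_ballAvg_sub_mul_le (hg : LocallyIntegrable g volume) (x : Eucl n) (r c : ℝ) :
    ‖ballAvg n g x r - c‖ₑ * volume (ball x r) ≤ ∫⁻ y in ball x r, ‖g y - c‖ₑ := by
  have hint := integrableOn_ball_of_locallyIntegrable hg x r
  have hfin := volume_ball_ne_top x r
  have key : ∫ y in ball x r, (g y - c) = volume.real (ball x r) * (ballAvg n g x r - c) := by
    rw [integral_sub hint (integrableOn_const hfin), setIntegral_const, smul_eq_mul, mul_sub]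
    congr 1
    exact (measure_smul_setAverage g hfin).symm
  have := enorm_integral_le_lintegral_enorm (μ := volume.restrict (ball x r)) fun y => g y - c
  rw [key, enorm_mul, Real.enorm_of_nonneg measureReal_nonneg, ofReal_measureReal hfin] at this
  rwa [mul_comm]

lemma enorm_ballAvg_sub_le (hg : LocallyIntegrable g volume) {x : Eucl n} {r : ℝ}
    (hr : 0 < r) {c : ℝ} {T : ℝ≥0∞}
    (h : ∫⁻ y in ball x r, ‖g y - c‖ₑ ≤ T * volume (ball x r)) :
    ‖ballAvg n g x r - c‖ₑ ≤ T :=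
  (ENNReal.mul_le_mul_iff_left (volume_ball_ne_zero x hr) (volume_ball_ne_top x r)).1
    ((enorm_ballAvg_sub_mul_le hg x r c).trans h)

lemma enorm_ballAvg_sub_ballAvg_le (hg : LocallyIntegrable g volume)
    (hM : ∀ x r, 0 < r → ∫⁻ y in ball x r, ‖g y - ballAvg n g x r‖ₑ ≤ M * volume (ball x r))
    {x z : Eucl n} {r s : ℝ} (hr : 0 < r) (hs : 0 < s) (hsub : ball x r ⊆ ball z s) {D : ℝ≥0∞}
    (hvol : volume (ball z s) ≤ D * volume (ball x r)) :
    ‖ballAvg n g x r - ballAvg n g z s‖ₑ ≤ D * M := by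
  refine enorm_ballAvg_sub_le hg hr ?_
  calc _ ≤ ∫⁻ y in ball z s, ‖g y - ballAvg n g z s‖ₑ := lintegral_mono_set hsub
    _ ≤ M * volume (ball z s) := hM z s hs
    _ ≤ M * (D * volume (ball x r)) := by gcongr
    _ = D * M * volume (ball x r) := by ring

lemma lintegral_ball_two_mul_le (hg : LocallyIntegrable g volume)
    (hM : ∀ x r, 0 < r → ∫⁻ y in ball x r, ‖g y - ballAvg n g x r‖ₑ ≤ M * volume (ball x r))
    (x : Eucl n) {r : ℝ} (hr : 0 < r) :
    ∫⁻ y in ball x (2 * r), ‖g y - ballAvg n g x r‖ₑ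
      ≤ 2 ^ n * (1 + 2 ^ n) * M * volume (ball x r) := by
  have hvol := volume_ball_two_mul x x hr
  have havg := enorm_ballAvg_sub_ballAvg_le hg hM hr (by positivity : 0 < 2 * r)
    (ball_subset_ball (by linarith)) hvol.le
  calc _ ≤ ∫⁻ y in ball x (2 * r), (‖g y - ballAvg n g x (2 * r)‖ₑ + 2 ^ n * M) := by
        refine lintegral_mono fun y => ?_
        rw [← sub_add_sub_cancel (g y) (ballAvg n g x (2 * r))]
        refine (enorm_add_le _ _).trans ?_
        gcongr
        rwa [← enorm_neg, neg_sub]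
    _ ≤ M * volume (ball x (2 * r)) + 2 ^ n * M * volume (ball x (2 * r)) := by
        rw [lintegral_add_right _ measurable_const, setLIntegral_const]
        gcongr
        exact hM x _ (by positivity)
    _ = _ := by rw [hvol]; ring

lemma ae_tendsto_ballAvg (hg : LocallyIntegrable g volume) :
    ∀ᵐ z : Eucl n, ∀ δ : ℕ → ℝ, Tendsto δ atTop (𝓝[>] 0) →
      Tendsto (fun j => ballAvg n g z (δ j)) atTop (𝓝 (g z)) := by
  filter_upwards [IsUnifLocDoublingMeasure.ae_tendsto_average volume hg 1] with z hz δ hδ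
  have hpos : ∀ᶠ j in atTop, 0 < δ j := hδ.eventually self_mem_nhdsWithin
  refine (hz (fun _ => z) δ hδ ?_).congr' ?_
  · filter_upwards [hpos] with j hj
    simpa using hj.le
  · filter_upwards [hpos] with j hj
    refine setAverage_congr ?_
    refine (ae_eq_of_subset_of_measure_ge ball_subset_closedBall
      ?_
      measurableSet_ball.nullMeasurableSet measure_closedBall_lt_top.ne).symm
    rw [Measure.addHaar_closedBall volume z hj.le, Measure.addHaar_ball_of_pos volume z hj]

/-- Stopping-time selection of balls on which the oscillation of `g` about its mean over a given
ball first exceeds the level `T`. -/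
lemma exists_stopping_balls (hg : LocallyIntegrable g volume)
    (hM : ∀ x r, 0 < r → ∫⁻ y in ball x r, ‖g y - ballAvg n g x r‖ₑ ≤ M * volume (ball x r))
    (x₀ : Eucl n) {r₀ : ℝ} (hr₀ : 0 < r₀) {T : ℝ≥0∞} (hT : 2 ^ n * (1 + 2 ^ n) * M ≤ T) :
    ∃ (u : Set (Eucl n)) (s : Eucl n → ℝ), u.Countable ∧ (∀ x ∈ u, 0 < s x) ∧
      (∀ᵐ z : Eucl n, z ∈ ball x₀ r₀ →
        ‖g z - ballAvg n g x₀ r₀‖ₑ ≤ T ∨ ∃ x ∈ u, z ∈ ball x (s x)) ∧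
      (∀ x ∈ u, ‖ballAvg n g x (s x) - ballAvg n g x₀ r₀‖ₑ ≤ (2 ^ n) ^ 2 * M + T) ∧
      T * ∑' x : u, volume (ball (x : Eucl n) (s x))
        ≤ (2 ^ n) ^ 4 * (1 + 2 ^ n) * M * volume (ball x₀ r₀) := by
  set c := ballAvg n g x₀ r₀ with hc
  have h2B := lintegral_ball_two_mul_le hg hM x₀ hr₀
  rw [← hc] at h2B
  set ρ : ℕ → ℝ := fun j => (1 / 2) ^ j * r₀ with hρ
  have hρpos : ∀ j, 0 < ρ j := fun j => by positivity
  have hρle : ∀ j, ρ j ≤ r₀ := fun j =>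
    mul_le_of_le_one_left hr₀.le (pow_le_one₀ (by norm_num) (by norm_num))
  have hρlim : Tendsto ρ atTop (𝓝[>] 0) := by
    refine tendsto_nhdsWithin_iff.2 ⟨?_, Eventually.of_forall hρpos⟩
    simpa [hρ] using (tendsto_pow_atTop_nhds_zero_of_lt_one (r := (1 / 2 : ℝ)) (by norm_num)
      (by norm_num)).mul_const r₀
  have hsub : ∀ x ∈ ball x₀ r₀, ∀ j, ball x (ρ j) ⊆ ball x₀ (2 * r₀) := fun x hx j =>
    ball_subset_ball' (by have := hρle j; have := mem_ball.1 hx; linarith)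
  set P : Eucl n → ℕ → Prop := fun x j =>
    T * volume (ball x (ρ j)) < ∫⁻ y in ball x (ρ j), ‖g y - c‖ₑ with hP
  have hP0 : ∀ x ∈ ball x₀ r₀, ¬ P x 0 := fun x hx => by
    have hρ0 : ρ 0 = r₀ := by simp [hρ]
    have hv : volume (ball x r₀) = volume (ball x₀ r₀) := by
      simpa using volume_ball_two_pow_mul x x₀ hr₀ 0
    simp only [hP, not_lt]
    calc _ ≤ _ := lintegral_mono_set (hsub x hx 0)
      _ ≤ _ := h2B
      _ ≤ T * volume (ball x (ρ 0)) := by rw [hρ0, hv]; gcongr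
  have hfirst : ∀ x ∈ ball x₀ r₀, (∃ j, P x j) → ∃ j, P x (j + 1) ∧ ¬ P x j := by
    rintro x hx ⟨j, hj⟩
    by_contra! hcon
    induction j with
    | zero => exact hP0 x hx hj
    | succ j ih => exact ih (hcon j hj)
  set t : Set (Eucl n) := {x | x ∈ ball x₀ r₀ ∧ ∃ j, P x j} with ht
  have hchoice : ∀ x, ∃ j, x ∈ t → P x (j + 1) ∧ ¬ P x j := fun x => by
    by_cases hx : x ∈ t
    · exact (hfirst x hx.1 hx.2).imp fun j hj _ => hj
    · exact ⟨0, fun h => absurd h hx⟩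
  choose J hJ using hchoice
  set σ : Eucl n → ℝ := fun x => ρ (J x + 1) with hσ
  obtain ⟨u, hut, hdisj, hcov⟩ :=
    Vitali.exists_disjoint_subfamily_covering_enlargement_closedBall t id σ r₀
      (fun a _ => hρle _) 4 (by norm_num)
  have hσpos : ∀ x, 0 < σ x := fun x => hρpos _
  have hucount : u.Countable := hdisj.countable_of_nonempty_interior fun x _ =>
    ⟨x, ball_subset_interior_closedBall (mem_ball_self (hσpos x))⟩
  have h2σ : ∀ x, 2 * σ x = ρ (J x) := fun x => by simp only [hσ, hρ]; ring
  refine ⟨u, fun x => 2 ^ 3 * σ x, hucount, fun x _ => by have := hσpos x; positivity,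
    ?_, ?_, ?_⟩
  · filter_upwards [ae_tendsto_ballAvg hg] with z hz hzB
    by_cases hzt : z ∈ t
    · right
      obtain ⟨b, hb, hzb⟩ := hcov z hzt
      refine ⟨b, hb, ?_⟩
      have h1 := mem_closedBall.1 (hzb (mem_closedBall_self (hσpos z).le))
      have h2 := hσpos b
      simp only [id] at h1
      rw [mem_ball]
      linarith
    · left
      have hz' : ∀ j, ¬ P z j := fun j hj => hzt ⟨hzB, j, hj⟩
      refine le_of_tendsto (((hz ρ hρlim).sub_const c).enorm) (Eventually.of_forall fun j => ?_)
      exact enorm_ballAvg_sub_le hg (hρpos j) (not_lt.1 (hz' j))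
  · intro x hx
    have h1 : ‖ballAvg n g x (2 * σ x) - c‖ₑ ≤ T := by
      rw [h2σ]
      exact enorm_ballAvg_sub_le hg (hρpos _) (not_lt.1 (hJ x (hut hx)).2)
    have hσx := hσpos x
    have h2 : ‖ballAvg n g x (2 * σ x) - ballAvg n g x (2 ^ 3 * σ x)‖ₑ ≤ (2 ^ n) ^ 2 * M := by
      refine enorm_ballAvg_sub_ballAvg_le hg hM (by positivity) (by positivity)
        (ball_subset_ball (by linarith)) ?_
      rw [← volume_ball_two_pow_mul x x (by positivity : 0 < 2 * σ x) 2]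
      apply le_of_eq
      congr 2
      ring
    rw [← sub_add_sub_cancel _ (ballAvg n g x (2 * σ x))]
    refine (enorm_add_le _ _).trans (add_le_add ?_ h1)
    rwa [← enorm_neg, neg_sub]
  · have hdisj' : u.PairwiseDisjoint fun x => ball x (σ x) :=
      hdisj.mono_on fun x _ => ball_subset_closedBall
    calc T * ∑' x : u, volume (ball (x : Eucl n) (2 ^ 3 * σ x))
        = (2 ^ n) ^ 3 * ∑' x : u, T * volume (ball (x : Eucl n) (σ x)) := by
          rw [ENNReal.tsum_mul_left, ← mul_assoc, mul_comm ((2 ^ n) ^ 3) T, mul_assoc,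
            ← ENNReal.tsum_mul_left (a := (2 ^ n) ^ 3)]
          congr 2
          ext x
          exact volume_ball_two_pow_mul _ _ (hσpos _) 3
      _ ≤ (2 ^ n) ^ 3 * ∑' x : u, ∫⁻ y in ball (x : Eucl n) (σ x), ‖g y - c‖ₑ := by
          gcongr with x
          exact (hJ x (hut x.2)).1.le
      _ = (2 ^ n) ^ 3 * ∫⁻ y in ⋃ x ∈ u, ball x (σ x), ‖g y - c‖ₑ := by
          rw [lintegral_biUnion hucount (fun _ _ => measurableSet_ball) hdisj']
      _ ≤ (2 ^ n) ^ 3 * (2 ^ n * (1 + 2 ^ n) * M * volume (ball x₀ r₀)) := by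
          gcongr
          exact (lintegral_mono_set (iUnion₂_subset fun x hx => hsub x (hut hx).1 _)).trans h2B
      _ = _ := by ring

/-- The constant in the `L^p` form of the John–Nirenberg inequality. -/
noncomputable def johnNirenbergConst (n : ℕ) (p : ℝ) : ℝ :=
  (2 ^ n) ^ 2 + (2 ^ n) ^ 4 * (1 + 2 ^ n) * 2 ^ p

lemma johnNirenbergConst_pos (n : ℕ) (p : ℝ) : 0 < johnNirenbergConst n p := by
  unfold johnNirenbergConst
  positivity

lemma ofReal_johnNirenbergConst (n : ℕ) (p : ℝ) :
    ENNReal.ofReal (johnNirenbergConst n p) =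
      (2 ^ n) ^ 2 + (2 ^ n) ^ 4 * (1 + 2 ^ n) * 2 ^ p := by
  have h2 : ENNReal.ofReal (2 ^ n) = 2 ^ n := by
    rw [ENNReal.ofReal_pow (by norm_num), ENNReal.ofReal_ofNat]
  rw [johnNirenbergConst, ENNReal.ofReal_add (by positivity) (by positivity),
    ENNReal.ofReal_mul (by positivity), ENNReal.ofReal_mul (by positivity),
    ENNReal.ofReal_add (by positivity) (by positivity), ENNReal.ofReal_pow (n := 2) (by positivity),
    ENNReal.ofReal_pow (n := 4) (by positivity), ← ENNReal.ofReal_rpow_of_pos (by norm_num), h2,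
    ENNReal.ofReal_one, ENNReal.ofReal_ofNat]

lemma min_enorm_rpow_le {p : ℝ} (hp : 1 ≤ p) {a b c : ℝ} {A : ℝ≥0∞} (h : ‖b - c‖ₑ ≤ A)
    (N : ℝ≥0∞) :
    min ‖a - c‖ₑ N ^ p ≤ 2 ^ (p - 1) * (min ‖a - b‖ₑ N ^ p + A ^ p) := by
  refine le_trans ?_ (ENNReal.rpow_add_le_mul_rpow_add_rpow _ _ hp)
  gcongr
  rw [← min_add_add_right]
  refine min_le_min ?_ le_self_add
  rw [← sub_add_sub_cancel a b c]
  exact (enorm_add_le _ _).trans (by gcongr)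

/-- Self-improvement of a bound for the truncated `p`-th order oscillation over all balls. -/
lemma two_mul_lintegral_min_enorm_rpow_le (hg : LocallyIntegrable g volume) (hM0 : M ≠ 0)
    (hMtop : M ≠ ⊤)
    (hM : ∀ x r, 0 < r → ∫⁻ y in ball x r, ‖g y - ballAvg n g x r‖ₑ ≤ M * volume (ball x r))
    {p : ℝ} (hp : 1 ≤ p) {N F : ℝ≥0∞}
    (hF : ∀ x r, 0 < r →
      ∫⁻ y in ball x r, min ‖g y - ballAvg n g x r‖ₑ N ^ p ≤ F * volume (ball x r))
    (x₀ : Eucl n) {r₀ : ℝ} (hr₀ : 0 < r₀) :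
    2 * ∫⁻ y in ball x₀ r₀, min ‖g y - ballAvg n g x₀ r₀‖ₑ N ^ p
      ≤ (3 * (ENNReal.ofReal (johnNirenbergConst n p) * M) ^ p + F) * volume (ball x₀ r₀) := by
  have hp0 : 0 < p := by linarith
  set D : ℝ≥0∞ := 2 ^ n with hD
  have hDtop : D ≠ ⊤ := by simp [hD]
  have hD0 : D ≠ 0 := by simp [hD]
  set B := D ^ 4 * (1 + D) * M with hB
  have hB0 : B ≠ 0 := by simp [hB, hD0, hM0]
  have hBtop : B ≠ ⊤ := by finiteness
  have h2p : (1 : ℝ≥0∞) ≤ 2 ^ p := ENNReal.one_le_rpow (by norm_num) hp0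
  have hDone : (1 : ℝ≥0∞) ≤ D := one_le_pow₀ (by norm_num)
  have hT : D * (1 + D) * M ≤ B * 2 ^ p := by
    calc D * (1 + D) * M = D * (1 + D) * M * 1 := by ring
      _ ≤ B * 2 ^ p := by
        rw [hB]
        gcongr
        exact le_self_pow₀ hDone (by norm_num)
  obtain ⟨u, s, hu, hs, hcov, havg, hsum⟩ := exists_stopping_balls hg hM x₀ hr₀ hT
  set c := ballAvg n g x₀ r₀
  set V := volume (ball x₀ r₀)
  set S := ∑' x : u, volume (ball (x : Eucl n) (s x))
  set A := ENNReal.ofReal (johnNirenbergConst n p) * M with hA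
  have hAeq : D ^ 2 * M + B * 2 ^ p = A := by
    rw [hA, ofReal_johnNirenbergConst, hB]
    ring
  have hSV : 2 ^ p * S ≤ V := by
    rw [← ENNReal.mul_le_mul_iff_right hB0 hBtop, ← mul_assoc]
    exact hsum
  set f : Eucl n → ℝ≥0∞ := fun y => min ‖g y - c‖ₑ N ^ p
  set W := ⋃ x ∈ u, ball x (s x) with hW
  have hWmeas : MeasurableSet W := MeasurableSet.biUnion hu fun _ _ => measurableSet_ball
  have hgood : ∫⁻ y in ball x₀ r₀ \ W, f y ≤ A ^ p * V := by
    calc _ ≤ ∫⁻ _ in ball x₀ r₀ \ W, A ^ p := by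
          refine setLIntegral_mono_ae measurable_const.aemeasurable ?_
          filter_upwards [hcov] with z hz hzW
          rcases hz hzW.1 with h | ⟨x, hx, hzx⟩
          · refine ENNReal.rpow_le_rpow ((min_le_left _ _).trans (h.trans ?_)) hp0.le
            rw [← hAeq]
            exact le_add_self
          · exact absurd (mem_biUnion hx hzx) hzW.2
      _ ≤ A ^ p * V := by
          rw [setLIntegral_const]
          gcongr
          exact measure_mono sdiff_subset
  have hbad : ∫⁻ y in ball x₀ r₀ ∩ W, f y ≤ 2 ^ (p - 1) * (F + A ^ p) * S := by
    have : Countable u := hu.to_subtype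
    calc _ ≤ ∫⁻ y in ⋃ x : u, ball (x : Eucl n) (s x), f y := by
          refine lintegral_mono_set (inter_subset_right.trans ?_)
          rw [hW, biUnion_eq_iUnion]
      _ ≤ ∑' x : u, ∫⁻ y in ball (x : Eucl n) (s x), f y := lintegral_iUnion_le _ _
      _ ≤ ∑' x : u, 2 ^ (p - 1) * (F + A ^ p) * volume (ball (x : Eucl n) (s x)) := by
          refine ENNReal.tsum_le_tsum fun x => ?_
          calc _ ≤ ∫⁻ y in ball (x : Eucl n) (s x),
                2 ^ (p - 1) * (min ‖g y - ballAvg n g x (s x)‖ₑ N ^ p + A ^ p) :=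
              lintegral_mono fun y => min_enorm_rpow_le hp (hAeq ▸ havg x x.2) N
            _ = 2 ^ (p - 1) * ((∫⁻ y in ball (x : Eucl n) (s x),
                  min ‖g y - ballAvg n g x (s x)‖ₑ N ^ p)
                    + A ^ p * volume (ball (x : Eucl n) (s x))) := by
              rw [lintegral_const_mul' _ _ (by finiteness),
                lintegral_add_right _ measurable_const, setLIntegral_const]
            _ ≤ _ := by
              rw [mul_assoc, add_mul]
              gcongr
              exact hF x _ (hs x x.2)
      _ = _ := ENNReal.tsum_mul_left
  have h2 : (2 : ℝ≥0∞) * 2 ^ (p - 1) = 2 ^ p := by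
    rw [ENNReal.rpow_sub _ _ (by norm_num) (by norm_num), ENNReal.rpow_one,
      ENNReal.mul_div_cancel (by norm_num) (by norm_num)]
  calc 2 * ∫⁻ y in ball x₀ r₀, f y
      = 2 * ((∫⁻ y in ball x₀ r₀ ∩ W, f y) + ∫⁻ y in ball x₀ r₀ \ W, f y) := by
        rw [lintegral_inter_add_sdiff f _ hWmeas]
    _ ≤ 2 * (2 ^ (p - 1) * (F + A ^ p) * S + A ^ p * V) := by gcongr
    _ = (F + A ^ p) * ((2 * 2 ^ (p - 1)) * S) + 2 * A ^ p * V := by ring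
    _ ≤ (F + A ^ p) * V + 2 * A ^ p * V := by rw [h2]; gcongr
    _ = _ := by ring

lemma lintegral_min_enorm_rpow_le (hg : LocallyIntegrable g volume) (hM0 : M ≠ 0)
    (hMtop : M ≠ ⊤)
    (hM : ∀ x r, 0 < r → ∫⁻ y in ball x r, ‖g y - ballAvg n g x r‖ₑ ≤ M * volume (ball x r))
    {p : ℝ} (hp : 1 ≤ p) (N : ℕ) (x : Eucl n) {r : ℝ} (hr : 0 < r) :
    ∫⁻ y in ball x r, min ‖g y - ballAvg n g x r‖ₑ N ^ p
      ≤ 3 * (ENNReal.ofReal (johnNirenbergConst n p) * M) ^ p * volume (ball x r) := by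
  have hp0 : 0 < p := by linarith
  set A := ENNReal.ofReal (johnNirenbergConst n p) * M
  set I : Eucl n → ℝ → ℝ≥0∞ := fun x r => ∫⁻ y in ball x r, min ‖g y - ballAvg n g x r‖ₑ N ^ p
  set F : ℝ≥0∞ := ⨆ (x : Eucl n) (r : ℝ) (_ : 0 < r), I x r / volume (ball x r) with hFdef
  have hF : ∀ x r, 0 < r → I x r ≤ F * volume (ball x r) := fun x r hr => by
    rw [← ENNReal.div_le_iff (volume_ball_ne_zero x hr) (volume_ball_ne_top x r)]
    exact le_iSup₂_of_le x r (le_iSup_of_le hr le_rfl)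
  have hFtop : F ≠ ⊤ := by
    refine ne_top_of_le_ne_top (b := (N : ℝ≥0∞) ^ p) (by finiteness) ?_
    refine iSup₂_le fun x r => iSup_le fun hr => ?_
    rw [ENNReal.div_le_iff (volume_ball_ne_zero x hr) (volume_ball_ne_top x r),
      ← setLIntegral_const]
    exact lintegral_mono fun y => ENNReal.rpow_le_rpow (min_le_right _ _) hp0.le
  have hF3 : F ≤ 3 * A ^ p := by
    have h2F : 2 * F ≤ 3 * A ^ p + F := by
      simp only [hFdef, ENNReal.mul_iSup]
      refine iSup₂_le fun x r => iSup_le fun hr => ?_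
      rw [← mul_div_assoc, ENNReal.div_le_iff (volume_ball_ne_zero x hr) (volume_ball_ne_top x r)]
      exact two_mul_lintegral_min_enorm_rpow_le hg hM0 hMtop hM hp hF x hr
    rw [two_mul] at h2F
    exact (ENNReal.add_le_add_iff_right hFtop).1 h2F
  exact (hF x r hr).trans (by gcongr)

/-- The `L^p` form of the John–Nirenberg inequality. -/
lemma lintegral_enorm_sub_ballAvg_rpow_le (hg : LocallyIntegrable g volume) (hM0 : M ≠ 0)
    (hMtop : M ≠ ⊤)
    (hM : ∀ x r, 0 < r → ∫⁻ y in ball x r, ‖g y - ballAvg n g x r‖ₑ ≤ M * volume (ball x r))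
    {p : ℝ} (hp : 1 ≤ p) (x : Eucl n) {r : ℝ} (hr : 0 < r) :
    ∫⁻ y in ball x r, ‖g y - ballAvg n g x r‖ₑ ^ p
      ≤ 3 * (ENNReal.ofReal (johnNirenbergConst n p) * M) ^ p * volume (ball x r) := by
  have hp0 : 0 < p := by linarith
  have hlim : ∀ a : ℝ, Tendsto (fun N : ℕ => min ‖a‖ₑ N ^ p) atTop (𝓝 (‖a‖ₑ ^ p)) := fun a => by
    refine tendsto_const_nhds.congr' ?_
    obtain ⟨N, hN⟩ := ENNReal.exists_nat_gt (enorm_ne_top (x := a))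
    filter_upwards [eventually_ge_atTop N] with m hm
    rw [min_eq_left (hN.le.trans (by exact_mod_cast hm))]
  have hmeas : AEMeasurable g := hg.aestronglyMeasurable.aemeasurable
  calc _ = ∫⁻ y in ball x r, liminf (fun N : ℕ => min ‖g y - ballAvg n g x r‖ₑ N ^ p) atTop :=
        lintegral_congr fun y => (hlim _).liminf_eq.symm
    _ ≤ liminf (fun N : ℕ => ∫⁻ y in ball x r, min ‖g y - ballAvg n g x r‖ₑ N ^ p) atTop :=
        lintegral_liminf_le' fun N =>
          ((((hmeas.sub_const _).enorm).min aemeasurable_const).pow_const p).restrict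
    _ ≤ _ := liminf_le_of_frequently_le' (Frequently.of_forall fun N =>
        lintegral_min_enorm_rpow_le hg hM0 hMtop hM hp N x hr)

lemma enorm_ballAvg_sub_ballAvg_le_of_le_two_pow (hg : LocallyIntegrable g volume)
    (hM : ∀ x r, 0 < r → ∫⁻ y in ball x r, ‖g y - ballAvg n g x r‖ₑ ≤ M * volume (ball x r))
    (x : Eucl n) {r : ℝ} (hr : 0 < r) (j : ℕ) {s : ℝ} (hrs : r ≤ s) (hs : s ≤ 2 ^ j * r) :
    ‖ballAvg n g x s - ballAvg n g x r‖ₑ ≤ j * (2 ^ n * M) := by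
  induction j generalizing s with
  | zero =>
    obtain rfl : s = r := by linarith
    simp
  | succ j ih =>
    have hpos : 0 < max r (s / 2) := lt_max_of_lt_left hr
    have h1 : max r (s / 2) ≤ s := max_le hrs (by linarith)
    have h2 : s ≤ 2 * max r (s / 2) := by linarith [le_max_right r (s / 2)]
    have h3 : max r (s / 2) ≤ 2 ^ j * r := by
      refine max_le (le_mul_of_one_le_left hr.le (one_le_pow₀ (by norm_num))) ?_
      rw [pow_succ] at hs
      linarith
    have hstep := enorm_ballAvg_sub_ballAvg_le hg hM (x := x) (z := x) hpos (by linarith)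
      (ball_subset_ball h1)
      ((measure_mono (ball_subset_ball h2)).trans (volume_ball_two_mul x x hpos).le)
    rw [← sub_add_sub_cancel _ (ballAvg n g x (max r (s / 2)))]
    refine (enorm_add_le _ _).trans ?_
    rw [← enorm_neg, neg_sub]
    refine (add_le_add hstep (ih (le_max_left _ _) h3)).trans_eq ?_
    push_cast
    ring

/-- The Morrey norm is dominated by the `L^p` norm. -/
lemma morreyNorm_le_lintegral {f : Eucl n → ℝ} (hf : AEStronglyMeasurable f volume) {p q : ℝ}
    (hq : 1 ≤ q) (hqp : q ≤ p) :
    morreyNorm n p q f ≤ (∫⁻ y, ‖f y‖ₑ ^ p) ^ (1 / p) := by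
  have hq0 : 0 < q := by linarith
  have hp0 : 0 < p := by linarith
  refine iSup₂_le fun x r => iSup_le fun hr => ?_
  have hV0 := volume_ball_ne_zero x hr
  have hVtop := volume_ball_ne_top x r
  have hHolder := eLpNorm'_le_eLpNorm'_mul_rpow_measure_univ (μ := volume.restrict (ball x r))
    hq0 hqp hf.restrict
  simp only [eLpNorm', Measure.restrict_apply_univ] at hHolder
  have hpow : ∀ y, ENNReal.ofReal (|f y| ^ q) = ‖f y‖ₑ ^ q := fun y => by
    rw [Real.enorm_eq_ofReal_abs, ENNReal.ofReal_rpow_of_nonneg (abs_nonneg _) hq0.le]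
  simp only [hpow]
  calc _ ≤ volume (ball x r) ^ (1 / p - 1 / q) * ((∫⁻ y in ball x r, ‖f y‖ₑ ^ p) ^ (1 / p) *
          volume (ball x r) ^ (1 / q - 1 / p)) := by gcongr
    _ = (∫⁻ y in ball x r, ‖f y‖ₑ ^ p) ^ (1 / p) := by
        rw [mul_left_comm, ← ENNReal.rpow_add _ _ hV0 hVtop]
        simp
    _ ≤ _ := by
        gcongr
        exact Measure.restrict_le_self

lemma lintegral_enorm_sub_ballAvg_le_of_bmoNorm_le (hM : bmoNorm n g ≤ M) (x : Eucl n) {r : ℝ}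
    (hr : 0 < r) :
    ∫⁻ y in ball x r, ‖g y - ballAvg n g x r‖ₑ ≤ M * volume (ball x r) := by
  have h : (volume (ball x r))⁻¹ * ∫⁻ y in ball x r, ‖g y - ballAvg n g x r‖ₑ ≤ M := by
    refine le_trans ?_ hM
    simp only [Real.enorm_eq_ofReal_abs]
    exact le_iSup₂_of_le (f := fun (x : Eucl n) (r : ℝ) => ⨆ _ : 0 < r, (volume (ball x r))⁻¹ *
      ∫⁻ y in ball x r, ENNReal.ofReal |g y - ballAvg n g x r|) x r (le_iSup_of_le hr le_rfl)
  rwa [mul_comm, ← div_eq_mul_inv,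
    ENNReal.div_le_iff (volume_ball_ne_zero x hr) (volume_ball_ne_top x r)] at h

lemma lintegral_enorm_sub_const_rpow_le (hg : LocallyIntegrable g volume) (hM0 : M ≠ 0)
    (hMtop : M ≠ ⊤)
    (hM : ∀ x r, 0 < r → ∫⁻ y in ball x r, ‖g y - ballAvg n g x r‖ₑ ≤ M * volume (ball x r))
    {p : ℝ} (hp : 1 ≤ p) (x : Eucl n) {r : ℝ} (hr : 0 < r) (a : ℝ) :
    (∫⁻ y in ball x r, ‖g y - a‖ₑ ^ p) ^ (1 / p)
      ≤ (3 * ENNReal.ofReal (johnNirenbergConst n p) * M + ‖ballAvg n g x r - a‖ₑ)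
        * volume (ball x r) ^ (1 / p) := by
  have hp0 : 0 < p := by linarith
  have hmeas : AEMeasurable g := hg.aestronglyMeasurable.aemeasurable
  set c := ballAvg n g x r
  set A := ENNReal.ofReal (johnNirenbergConst n p) * M with hA
  have h3 : (3 : ℝ≥0∞) ^ (1 / p) ≤ 3 := by
    conv_rhs => rw [← ENNReal.rpow_one 3]
    exact ENNReal.rpow_le_rpow_of_exponent_le (by norm_num) ((div_le_one hp0).2 hp)
  have hroot : ∀ b : ℝ≥0∞, (b ^ p) ^ (1 / p) = b := fun b => by
    rw [← ENNReal.rpow_mul, mul_one_div_cancel hp0.ne', ENNReal.rpow_one]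
  have h1p : 0 ≤ 1 / p := by positivity
  calc _ ≤ (∫⁻ y in ball x r, (‖g y - c‖ₑ + ‖c - a‖ₑ) ^ p) ^ (1 / p) := by
        gcongr with y
        rw [← sub_add_sub_cancel (g y) c a]
        exact enorm_add_le _ _
    _ ≤ (∫⁻ y in ball x r, ‖g y - c‖ₑ ^ p) ^ (1 / p)
          + (∫⁻ _ in ball x r, ‖c - a‖ₑ ^ p) ^ (1 / p) :=
        ENNReal.lintegral_Lp_add_le ((hmeas.sub_const _).enorm.restrict) aemeasurable_const hp
    _ ≤ (3 * A ^ p * volume (ball x r)) ^ (1 / p)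
          + (‖c - a‖ₑ ^ p * volume (ball x r)) ^ (1 / p) := by
        rw [setLIntegral_const]
        gcongr
        exact lintegral_enorm_sub_ballAvg_rpow_le hg hM0 hMtop hM hp x hr
    _ = (3 ^ (1 / p) * A + ‖c - a‖ₑ) * volume (ball x r) ^ (1 / p) := by
        rw [ENNReal.mul_rpow_of_nonneg _ _ h1p, ENNReal.mul_rpow_of_nonneg _ _ h1p,
          ENNReal.mul_rpow_of_nonneg _ _ h1p, hroot, hroot, add_mul]
    _ ≤ _ := by
        rw [mul_assoc 3, ← hA]
        gcongr

lemma morreyNorm_indicator_le {E : Set (Eucl n)} (hE : MeasurableSet E) {x : Eucl n} {r : ℝ}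
    (hsub : E ⊆ ball x r) (hg : LocallyIntegrable g volume) (a : ℝ) {p q : ℝ} (hq : 1 ≤ q)
    (hqp : q ≤ p) :
    morreyNorm n p q (E.indicator fun y => |g y - a|)
      ≤ (∫⁻ y in ball x r, ‖g y - a‖ₑ ^ p) ^ (1 / p) := by
  have hp0 : 0 < p := by linarith
  have hmeas : AEStronglyMeasurable (E.indicator fun y => |g y - a|) volume :=
    ((hg.aestronglyMeasurable.sub aestronglyMeasurable_const).norm).indicator hE
  refine (morreyNorm_le_lintegral hmeas hq hqp).trans ?_
  refine ENNReal.rpow_le_rpow ?_ (by positivity)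
  rw [← lintegral_indicator measurableSet_ball]
  refine lintegral_mono fun y => ?_
  by_cases hy : y ∈ E
  · simp [hy, hsub hy]
  · simp [hy, hp0]

/-- Morrey estimate on a subset of a ball, for a function of mean oscillation at most `m`. -/
lemma morreyNorm_indicator_le_of_bmoNorm_le {m : ℝ} (hm : 0 < m) (hg : LocallyIntegrable g volume)
    (hgm : bmoNorm n g ≤ ENNReal.ofReal m) {E : Set (Eucl n)} (hE : MeasurableSet E)
    {r s : ℝ} (hr : 0 < r) (hrs : 2 * r ≤ s) (hsub : E ⊆ ball 0 s) (a : ℝ) {p q : ℝ} (hq : 1 ≤ q)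
    (hqp : q ≤ p) :
    morreyNorm n p q (E.indicator fun y => |g y - a|) ≤
      ENNReal.ofReal ((3 * johnNirenbergConst n p + 2 * 2 ^ n)
        * (volume.real (ball (0 : Eucl n) 1) * s ^ n) ^ (1 / p)
        * (m * Real.logb 2 (s / r) + |a - ballAvg n g 0 r|)) := by
  have hp : 1 ≤ p := hq.trans hqp
  have hs : 0 < s := by linarith
  have hM : ∀ x r, 0 < r → ∫⁻ y in ball x r, ‖g y - ballAvg n g x r‖ₑ
      ≤ ENNReal.ofReal m * volume (ball x r) := fun x r hr =>
    lintegral_enorm_sub_ballAvg_le_of_bmoNorm_le hgm x hr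
  set κ := johnNirenbergConst n p
  have hκ : 0 < κ := johnNirenbergConst_pos n p
  set L := Real.logb 2 (s / r) with hL
  set v := volume.real (ball (0 : Eucl n) 1)
  have hL1 : 1 ≤ L := by
    rw [hL, Real.le_logb_iff_rpow_le (by norm_num) (by positivity), Real.rpow_one, le_div_iff₀ hr]
    exact hrs
  set j := ⌈L⌉₊
  have hj : (j : ℝ) ≤ 2 * L := by linarith [Nat.ceil_lt_add_one (by linarith : 0 ≤ L)]
  have hsj : s ≤ 2 ^ j * r := by
    rw [← div_le_iff₀ hr, ← Real.rpow_natCast, ← Real.logb_le_iff_le_rpow (by norm_num)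
      (by positivity)]
    exact Nat.le_ceil L
  have hchain := enorm_ballAvg_sub_ballAvg_le_of_le_two_pow hg hM (0 : Eucl n) hr j
    (by linarith) hsj
  set d := |a - ballAvg n g 0 r| with hd
  have hosc : ‖ballAvg n g 0 s - a‖ₑ ≤ ENNReal.ofReal (j * (2 ^ n * m) + d) := by
    rw [← sub_add_sub_cancel _ (ballAvg n g 0 r), ENNReal.ofReal_add (by positivity)
      (by positivity)]
    refine (enorm_add_le _ _).trans (add_le_add ?_ ?_)
    · rwa [ENNReal.ofReal_mul (by positivity), ENNReal.ofReal_mul (by positivity),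
        ENNReal.ofReal_natCast, ENNReal.ofReal_pow (by norm_num), ENNReal.ofReal_ofNat]
    · rw [Real.enorm_eq_ofReal_abs, abs_sub_comm]
  have hvol : volume (ball (0 : Eucl n) s) ^ (1 / p) = ENNReal.ofReal ((v * s ^ n) ^ (1 / p)) := by
    rw [Measure.addHaar_ball_of_pos volume 0 hs, finrank_euclideanSpace_fin,
      ← ENNReal.ofReal_rpow_of_nonneg (by positivity) (by positivity), mul_comm v,
      ENNReal.ofReal_mul (by positivity), ofReal_measureReal (volume_ball_ne_top 0 1)]
  have hm0 : ENNReal.ofReal m ≠ 0 := (ENNReal.ofReal_pos.2 hm).ne'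
  calc _ ≤ _ := morreyNorm_indicator_le hE hsub hg a hq hqp
    _ ≤ _ := lintegral_enorm_sub_const_rpow_le hg hm0 ENNReal.ofReal_ne_top hM hp 0 hs a
    _ ≤ (ENNReal.ofReal (3 * κ * m) + ENNReal.ofReal (j * (2 ^ n * m) + d))
          * ENNReal.ofReal ((v * s ^ n) ^ (1 / p)) := by
        rw [hvol, ENNReal.ofReal_mul (by positivity), ENNReal.ofReal_mul (by norm_num),
          ENNReal.ofReal_ofNat]
        gcongr
    _ = ENNReal.ofReal ((3 * κ * m + (j * (2 ^ n * m) + d)) * (v * s ^ n) ^ (1 / p)) := by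
        rw [← ENNReal.ofReal_add (by positivity) (by positivity),
          ← ENNReal.ofReal_mul (by positivity)]
    _ ≤ _ := by
        apply ENNReal.ofReal_le_ofReal
        rw [mul_right_comm _ ((v * s ^ n) ^ (1 / p))]
        have hw : 0 ≤ (v * s ^ n) ^ (1 / p) := by positivity
        refine mul_le_mul_of_nonneg_right ?_ hw
        have h1 : 3 * κ * m ≤ 3 * κ * m * L := le_mul_of_one_le_right (by positivity) hL1
        have h2 : j * (2 ^ n * m) ≤ 2 * L * (2 ^ n * m) := by gcongr
        have h3 : 1 * d ≤ (3 * κ + 2 * 2 ^ n) * d := by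
          gcongr
          have : (1 : ℝ) ≤ 2 ^ n := one_le_pow₀ (by norm_num)
          linarith
        linarith

end Oscillation

/-- BMO estimate on dyadic annuli: there is a constant depending only on
`n` and `p` bounding the Morrey norm of `χ_{B(0,2^{k+1}α)\B(0,2^kα)} |g - g(y)|`. -/
theorem morreyNorm_indicator_annulus_bmo_le
    (n : ℕ) (hn : 1 ≤ n) (p : ℝ) (hp : 1 ≤ p) :
    ∃ C : ℝ, 0 < C ∧ ∀ q : ℝ, 1 ≤ q → q ≤ p →
      ∀ g : Eucl n → ℝ, MemBMO n g →
      ∀ k : ℕ, ∀ α β : ℝ, 0 < β → β ≤ α →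
      ∀ y ∈ ball (0 : Eucl n) β,
        morreyNorm n p q
          ((ball (0 : Eucl n) (2 ^ (k + 1) * α) \ ball (0 : Eucl n) (2 ^ k * α)).indicator
            (fun x => |g x - g y|))
          ≤ ENNReal.ofReal (C * (2 ^ k * α) ^ ((n : ℝ) / p) *
            ((bmoNorm n g).toReal * Real.logb 2 (2 ^ (k + 1) * α / β) +
              |g y - ballAvg n g 0 β|)) := by
  set v := volume.real (ball (0 : Eucl n) 1)
  have hv0 : 0 < v :=
    ENNReal.toReal_pos (volume_ball_ne_zero 0 one_pos) (volume_ball_ne_top 0 1)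
  have hκ := johnNirenbergConst_pos n p
  refine ⟨(3 * johnNirenbergConst n p + 2 * 2 ^ n) * (v * 2 ^ n) ^ (1 / p), by positivity, ?_⟩
  intro q hq hqp g hg k α β hβ hβα y _
  have hα : 0 < α := hβ.trans_le hβα
  have hs : 2 * β ≤ 2 ^ (k + 1) * α := by
    rw [pow_succ']
    have : (1 : ℝ) ≤ 2 ^ k := one_le_pow₀ (by norm_num)
    nlinarith
  have hpow : (v * (2 ^ (k + 1) * α) ^ n) ^ (1 / p)
      = (v * 2 ^ n) ^ (1 / p) * (2 ^ k * α) ^ ((n : ℝ) / p) := by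
    rw [pow_succ', mul_assoc 2, mul_pow, ← mul_assoc, Real.mul_rpow (by positivity) (by positivity),
      ← Real.rpow_natCast (2 ^ k * α), ← Real.rpow_mul (by positivity), mul_one_div]
  have hlim : Filter.Tendsto (fun ε : ℝ => ENNReal.ofReal
      ((3 * johnNirenbergConst n p + 2 * 2 ^ n) * (v * 2 ^ n) ^ (1 / p)
        * (2 ^ k * α) ^ ((n : ℝ) / p)
        * (((bmoNorm n g).toReal + ε) * Real.logb 2 (2 ^ (k + 1) * α / β)
          + |g y - ballAvg n g 0 β|))) (nhdsWithin 0 (Set.Ioi 0))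
      (nhds (ENNReal.ofReal ((3 * johnNirenbergConst n p + 2 * 2 ^ n) * (v * 2 ^ n) ^ (1 / p)
        * (2 ^ k * α) ^ ((n : ℝ) / p)
        * (((bmoNorm n g).toReal + 0) * Real.logb 2 (2 ^ (k + 1) * α / β)
          + |g y - ballAvg n g 0 β|)))) := by
    refine (Continuous.tendsto ?_ 0).mono_left nhdsWithin_le_nhds
    exact ENNReal.continuous_ofReal.comp (by fun_prop)
  rw [add_zero] at hlim
  refine ge_of_tendsto hlim ?_
  filter_upwards [self_mem_nhdsWithin] with ε hε
  have hε0 : 0 < ε := hε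
  have hbmo : bmoNorm n g ≤ ENNReal.ofReal ((bmoNorm n g).toReal + ε) := by
    rw [← ENNReal.ofReal_toReal hg.2.ne, ENNReal.toReal_ofReal ENNReal.toReal_nonneg]
    exact ENNReal.ofReal_le_ofReal (by linarith)
  have h := morreyNorm_indicator_le_of_bmoNorm_le (by positivity) hg.1 hbmo
    ((measurableSet_ball (x := (0 : Eucl n)) (ε := 2 ^ (k + 1) * α)).diff
      (measurableSet_ball (x := (0 : Eucl n)) (ε := 2 ^ k * α)))
    hβ hs Set.sdiff_subset (g y) hq hqp
  rwa [hpow, ← mul_assoc] at h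
end

section
/- Let n ≥ 1 and 1 ≤ q ≤ p < ∞. A function f ∈ M^p_q(ℝ^n) belongs to tilde-M^p_q(ℝ^n), the closure of C_c^∞(ℝ^n) in the M^p_q norm, if and only if lim_{R → ∞} ‖f · χ_{{x : |f(x)| > R} ∪ (ℝ^n \ B(0,R))}‖_{M^p_q} = 0. -/
open MeasureTheory Metric ENNReal

namespace Morrey

variable {n : ℕ} {p q : ℝ} {f g : Eucl n → ℝ}

/-- The Morrey norm as a supremum of weighted local `L^q` norms. -/
lemma morreyNorm_eq_iSup_eLpNorm (hq : 1 ≤ q) :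
    morreyNorm n p q f = ⨆ (x : Eucl n) (r : ℝ) (_ : 0 < r),
      (volume (ball x r)) ^ (1 / p - 1 / q) *
        eLpNorm f (ENNReal.ofReal q) (volume.restrict (ball x r)) := by
  have hq0 : 0 < q := zero_lt_one.trans_le hq
  simp only [morreyNorm, eLpNorm_eq_lintegral_rpow_enorm_toReal
    (ENNReal.ofReal_pos.2 hq0).ne' ENNReal.ofReal_ne_top, ENNReal.toReal_ofReal hq0.le,
    Real.enorm_eq_ofReal_abs, ENNReal.ofReal_rpow_of_nonneg (abs_nonneg _) hq0.le]

lemma morreyNorm_mono (hq : 1 ≤ q) (hfg : ∀ x, |f x| ≤ |g x|) :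
    morreyNorm n p q f ≤ morreyNorm n p q g := by
  simp only [morreyNorm_eq_iSup_eLpNorm hq]
  gcongr
  exact eLpNorm_mono hfg

lemma morreyNorm_add_le (hq : 1 ≤ q) (hf : Measurable f) (hg : Measurable g) :
    morreyNorm n p q (f + g) ≤ morreyNorm n p q f + morreyNorm n p q g := by
  simp only [morreyNorm_eq_iSup_eLpNorm hq]
  refine iSup_le fun x => iSup_le fun r => iSup_le fun hr => ?_
  grw [eLpNorm_add_le hf.aestronglyMeasurable hg.aestronglyMeasurable
    (ENNReal.one_le_ofReal.2 hq), mul_add]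
  gcongr
  · exact le_iSup_of_le x (le_iSup_of_le r (le_iSup_of_le hr le_rfl))
  · exact le_iSup_of_le x (le_iSup_of_le r (le_iSup_of_le hr le_rfl))

/-- The embedding `L^p ⊆ M^p_q` has norm at most one. -/
lemma morreyNorm_le_eLpNorm (hq : 1 ≤ q) (hqp : q ≤ p) (hf : Measurable f) :
    morreyNorm n p q f ≤ eLpNorm f (ENNReal.ofReal p) volume := by
  have hq0 : 0 ≤ q := zero_le_one.trans hq
  rw [morreyNorm_eq_iSup_eLpNorm hq]
  refine iSup_le fun x => iSup_le fun r => iSup_le fun hr => ?_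
  have hpos : volume (ball x r) ≠ 0 := (measure_ball_pos volume x hr).ne'
  have hfin : volume (ball x r) ≠ ⊤ := measure_ball_lt_top.ne
  have hHolder := eLpNorm_le_eLpNorm_mul_rpow_measure_univ (ENNReal.ofReal_le_ofReal hqp)
    (hf.aestronglyMeasurable (μ := volume.restrict (ball x r)))
  rw [Measure.restrict_apply_univ, ENNReal.toReal_ofReal hq0,
    ENNReal.toReal_ofReal (hq0.trans hqp)] at hHolder
  calc (volume (ball x r)) ^ (1 / p - 1 / q) *
        eLpNorm f (ENNReal.ofReal q) (volume.restrict (ball x r))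
      ≤ (volume (ball x r)) ^ (1 / p - 1 / q) *
        (eLpNorm f (ENNReal.ofReal p) (volume.restrict (ball x r)) *
          (volume (ball x r)) ^ (1 / q - 1 / p)) := by gcongr
    _ = eLpNorm f (ENNReal.ofReal p) (volume.restrict (ball x r)) := by
      rw [mul_left_comm, ← ENNReal.rpow_add _ _ hpos hfin]
      simp
    _ ≤ eLpNorm f (ENNReal.ofReal p) volume := eLpNorm_mono_measure _ Measure.restrict_le_self

/-- The part of `f` where it is large, or far from the origin, is controlled by the distance from
`f` to a bounded function of bounded support. -/
lemma abs_indicator_le_two_mul_abs_sub {K R : ℝ} (hg : ∀ x, |g x| ≤ K) (hKR : 2 * K ≤ R)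
    (hsupp : Function.support g ⊆ ball 0 R) (x : Eucl n) :
    |({x | R < |f x|} ∪ (ball (0 : Eucl n) R)ᶜ).indicator f x| ≤ 2 * |f x - g x| := by
  by_cases hx : x ∈ {x | R < |f x|} ∪ (ball (0 : Eucl n) R)ᶜ
  · rw [Set.indicator_of_mem hx]
    rcases hx with hx | hx
    · have := abs_sub_abs_le_abs_sub (f x) (g x)
      have := hg x
      have : R < |f x| := hx
      linarith
    · rw [Function.notMem_support.1 fun h => hx (hsupp h), sub_zero]
      linarith [abs_nonneg (f x)]
  · rw [Set.indicator_of_notMem hx, abs_zero]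
    positivity

/-- The bounded, boundedly supported part of a measurable function lies in every `L^p`. -/
lemma memLp_indicator_compl (hf : Measurable f) (R : ℝ) (s : ℝ≥0∞) :
    MemLp (({x | R < |f x|} ∪ (ball (0 : Eucl n) R)ᶜ)ᶜ.indicator f) s volume := by
  have hm : MeasurableSet ({x | R < |f x|} ∪ (ball (0 : Eucl n) R)ᶜ) :=
    (measurableSet_lt measurable_const hf.abs).union measurableSet_ball.compl
  refine (memLp_indicator_const s (measurableSet_ball (x := (0 : Eucl n)) (ε := R)) R
    (Or.inr measure_ball_lt_top.ne)).of_le (hf.indicator hm.compl).aestronglyMeasurable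
    (Filter.Eventually.of_forall fun x => ?_)
  by_cases hx : x ∈ ({x | R < |f x|} ∪ (ball (0 : Eucl n) R)ᶜ)ᶜ
  · rw [Set.indicator_of_mem hx]
    simp only [Set.compl_union, compl_compl, Set.mem_inter_iff, Set.mem_compl_iff,
      Set.mem_ofPred_eq, not_lt] at hx
    rw [Set.indicator_of_mem hx.2, Real.norm_eq_abs]
    exact hx.1.trans (le_abs_self R)
  · rw [Set.indicator_of_notMem hx, norm_zero]
    exact norm_nonneg _

end Morrey

/-- characterization of the tilde subspace. -/
theorem memTildeMorrey_iff
    (n : ℕ) (hn : 1 ≤ n) (p q : ℝ) (hq : 1 ≤ q) (hqp : q ≤ p)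
    (f : Eucl n → ℝ) (hf : MemMorrey n p q f) :
    MemTildeMorrey n p q f ↔
      Filter.Tendsto
        (fun R : ℝ => morreyNorm n p q
          (({x | R < |f x|} ∪ (ball (0 : Eucl n) R)ᶜ).indicator f))
        Filter.atTop (nhds 0) := by
  constructor
  · rintro ⟨-, happrox⟩
    rw [ENNReal.tendsto_nhds_zero]
    intro ε hε
    obtain ⟨δ, hδ, hδε⟩ : ∃ δ : ℝ, 0 < δ ∧ ENNReal.ofReal δ + ENNReal.ofReal δ ≤ ε := by
      obtain ⟨η, hη, hηε⟩ := ENNReal.lt_iff_exists_nnreal_btwn.1 hε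
      have hη' : (0 : ℝ) < η := by exact_mod_cast hη
      refine ⟨η / 2, half_pos hη', ?_⟩
      rw [← ENNReal.ofReal_add (half_pos hη').le (half_pos hη').le, add_halves,
        ENNReal.ofReal_coe_nnreal]
      exact hηε.le
    obtain ⟨φ, ⟨hφ, hφc⟩, hlt⟩ := happrox δ hδ
    obtain ⟨K, hK⟩ := hφc.exists_bound_of_continuous hφ.continuous
    obtain ⟨R₀, hR₀⟩ := hφc.isCompact.isBounded.subset_ball (0 : Eucl n)
    have hmeas : Measurable fun x => f x - φ x := hf.1.sub hφ.continuous.measurable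
    filter_upwards [Filter.eventually_ge_atTop (2 * K), Filter.eventually_ge_atTop R₀]
      with R hKR hR
    calc _ ≤ morreyNorm n p q ((fun x => f x - φ x) + fun x => f x - φ x) := by
          refine Morrey.morreyNorm_mono hq fun x => ?_
          rw [Pi.add_apply, ← two_mul, abs_mul, abs_two]
          exact Morrey.abs_indicator_le_two_mul_abs_sub hK hKR
            ((subset_tsupport φ).trans (hR₀.trans (ball_subset_ball hR))) x
      _ ≤ ENNReal.ofReal δ + ENNReal.ofReal δ :=
          (Morrey.morreyNorm_add_le hq hmeas hmeas).trans (add_le_add hlt.le hlt.le)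
      _ ≤ ε := hδε
  · intro hlim
    refine ⟨hf, fun ε hε => ?_⟩
    obtain ⟨R, hR⟩ := (hlim.eventually_lt_const
      (ENNReal.ofReal_pos.2 (half_pos hε))).exists
    set E := {x | R < |f x|} ∪ (ball (0 : Eucl n) R)ᶜ with hE
    have hEm : MeasurableSet E :=
      (measurableSet_lt measurable_const hf.1.abs).union measurableSet_ball.compl
    obtain ⟨φ, hφc, hφ, hle⟩ := (Morrey.memLp_indicator_compl hf.1 R (ENNReal.ofReal p)
      ).exist_eLpNorm_sub_le ENNReal.ofReal_ne_top
      (ENNReal.one_le_ofReal.2 (hq.trans hqp)) (half_pos hε)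
    rw [← hE] at hle
    have hmeas : Measurable (Eᶜ.indicator f - φ) :=
      (hf.1.indicator hEm.compl).sub hφ.continuous.measurable
    refine ⟨φ, ⟨hφ, hφc⟩, ?_⟩
    have hsplit : (fun x => f x - φ x) = E.indicator f + (Eᶜ.indicator f - φ) := by
      rw [← add_sub_assoc, Set.indicator_self_add_compl]
      rfl
    calc morreyNorm n p q (fun x => f x - φ x)
        ≤ morreyNorm n p q (E.indicator f) + morreyNorm n p q (Eᶜ.indicator f - φ) := by
          rw [hsplit]
          exact Morrey.morreyNorm_add_le hq (hf.1.indicator hEm) hmeas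
      _ < ENNReal.ofReal (ε / 2) + ENNReal.ofReal (ε / 2) :=
          ENNReal.add_lt_add_of_lt_of_le
            (((Morrey.morreyNorm_le_eLpNorm hq hqp hmeas).trans hle).trans_lt
              ENNReal.ofReal_lt_top).ne hR
            ((Morrey.morreyNorm_le_eLpNorm hq hqp hmeas).trans hle)
      _ = ENNReal.ofReal ε := by
          rw [← ENNReal.ofReal_add (half_pos hε).le (half_pos hε).le, add_halves]
end

section
/- Let n ≥ 1 and 1 ≤ q ≤ p < ∞. A function f ∈ M^p_q(ℝ^n) belongs to bar-M^p_q(ℝ^n), the closure of L^∞(ℝ^n) ∩ M^p_q(ℝ^n) in the M^p_q norm, if and only if lim_{R → ∞} ‖f · χ_{{x : |f(x)| ≥ R}}‖_{M^p_q} = 0. -/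
open MeasureTheory Metric ENNReal

/-- The Morrey norm is monotone, up to a constant factor, in the absolute value. -/
theorem morreyNorm_le_of_ae_abs_le {n : ℕ} {p q c : ℝ} (hq : 0 < q) (hc : 0 ≤ c)
    {f g : Eucl n → ℝ} (h : ∀ᵐ x, |f x| ≤ c * |g x|) :
    morreyNorm n p q f ≤ ENNReal.ofReal c * morreyNorm n p q g := by
  refine iSup_le fun x => iSup_le fun r => iSup_le fun hr => ?_
  have hint : ∫⁻ y in ball x r, ENNReal.ofReal (|f y| ^ q) ≤
      ENNReal.ofReal c ^ q * ∫⁻ y in ball x r, ENNReal.ofReal (|g y| ^ q) := by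
    rw [← lintegral_const_mul' _ _ (by finiteness)]
    refine lintegral_mono_ae (ae_restrict_of_ae (h.mono fun y hy => ?_))
    rw [ENNReal.ofReal_rpow_of_nonneg hc hq.le, ← ENNReal.ofReal_mul (by positivity),
      ← Real.mul_rpow hc (abs_nonneg _)]
    gcongr
  calc volume (ball x r) ^ (1 / p - 1 / q) *
        (∫⁻ y in ball x r, ENNReal.ofReal (|f y| ^ q)) ^ (1 / q)
      ≤ volume (ball x r) ^ (1 / p - 1 / q) *
        (ENNReal.ofReal c ^ q * ∫⁻ y in ball x r, ENNReal.ofReal (|g y| ^ q)) ^ (1 / q) := by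
        gcongr
    _ = ENNReal.ofReal c * (volume (ball x r) ^ (1 / p - 1 / q) *
        (∫⁻ y in ball x r, ENNReal.ofReal (|g y| ^ q)) ^ (1 / q)) := by
        rw [ENNReal.mul_rpow_of_nonneg _ _ (by positivity), ← ENNReal.rpow_mul,
          mul_one_div_cancel hq.ne', ENNReal.rpow_one, mul_left_comm]
    _ ≤ ENNReal.ofReal c * morreyNorm n p q g := by
        gcongr
        exact le_iSup_of_le x (le_iSup_of_le r (le_iSup_of_le hr le_rfl))

/-- characterization of the bar subspace. -/
theorem memBarMorrey_iff
    (n : ℕ) (hn : 1 ≤ n) (p q : ℝ) (hq : 1 ≤ q) (hqp : q ≤ p)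
    (f : Eucl n → ℝ) (hf : MemMorrey n p q f) :
    MemBarMorrey n p q f ↔
      Filter.Tendsto
        (fun R : ℝ => morreyNorm n p q ({x | R ≤ |f x|}.indicator f))
        Filter.atTop (nhds 0) := by
  have hq0 : 0 < q := by linarith
  constructor
  · rintro ⟨-, happrox⟩
    refine ENNReal.tendsto_nhds_zero.2 fun ε hε => ?_
    obtain ⟨δ, -, hδ, hδε⟩ := ENNReal.lt_iff_exists_real_btwn.1 hε
    have hδ0 : 0 < δ := ENNReal.ofReal_pos.1 hδ
    obtain ⟨g, -, ⟨C, hC⟩, hfg⟩ := happrox (δ / 2) (by positivity)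
    filter_upwards [Filter.eventually_ge_atTop (2 * C)] with R hR
    have hdom : ∀ᵐ x, |({x | R ≤ |f x|}.indicator f) x| ≤ 2 * |f x - g x| := by
      filter_upwards [hC] with x hx
      by_cases hxR : x ∈ {x | R ≤ |f x|}
      · rw [Set.indicator_of_mem hxR]
        have hxR' : R ≤ |f x| := hxR
        have := abs_sub_abs_le_abs_sub (f x) (g x)
        linarith
      · rw [Set.indicator_of_notMem hxR, abs_zero]
        positivity
    calc morreyNorm n p q ({x | R ≤ |f x|}.indicator f)
        ≤ ENNReal.ofReal 2 * morreyNorm n p q (fun x => f x - g x) :=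
          morreyNorm_le_of_ae_abs_le hq0 zero_le_two hdom
      _ ≤ ENNReal.ofReal 2 * ENNReal.ofReal (δ / 2) := by gcongr
      _ = ENNReal.ofReal δ := by
          rw [← ENNReal.ofReal_mul zero_le_two, mul_div_cancel₀ δ two_ne_zero]
      _ ≤ ε := hδε.le
  · refine fun hlim => ⟨hf, fun ε hε => ?_⟩
    obtain ⟨R, hR, hR0⟩ := ((hlim.eventually_lt_const (ENNReal.ofReal_pos.2 hε)).and
      (Filter.eventually_ge_atTop 0)).exists
    have hmeas : MeasurableSet {x | R ≤ |f x|} :=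
      measurableSet_le measurable_const (continuous_abs.measurable.comp hf.1)
    refine ⟨{x | R ≤ |f x|}ᶜ.indicator f, ⟨hf.1.indicator hmeas.compl, ?_⟩,
      ⟨R, .of_forall fun x => ?_⟩, ?_⟩
    · have hle : morreyNorm n p q ({x | R ≤ |f x|}ᶜ.indicator f) ≤
          ENNReal.ofReal 1 * morreyNorm n p q f :=
        morreyNorm_le_of_ae_abs_le hq0 zero_le_one (.of_forall fun x => by
          simpa using norm_indicator_le_norm_self (s := {x | R ≤ |f x|}ᶜ) f x)
      rw [ENNReal.ofReal_one, one_mul] at hle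
      exact hle.trans_lt hf.2
    · by_cases hx : x ∈ {x | R ≤ |f x|}
      · simpa [hx] using hR0
      · rw [Set.indicator_of_mem (Set.mem_compl hx)]
        exact (not_le.1 hx).le
    · convert hR using 2
      ext x
      by_cases hx : x ∈ {x | R ≤ |f x|}
      · rw [Set.indicator_of_notMem (Set.notMem_compl_iff.2 hx), Set.indicator_of_mem hx, sub_zero]
      · rw [Set.indicator_of_mem (Set.mem_compl hx), Set.indicator_of_notMem hx, sub_self]
end

section
/- Let n ≥ 1 and 1 ≤ q ≤ p < ∞. A function f ∈ M^p_q(ℝ^n) belongs to star-M^p_q(ℝ^n), the closure in the M^p_q norm of the set of compactly supported measurable functions in M^p_q(ℝ^n), if and only if lim_{R → ∞} ‖f · χ_{ℝ^n \ B(0,R)}‖_{M^p_q} = 0. -/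
open MeasureTheory Metric ENNReal

/-- The Morrey norm is monotone in the absolute value of the function. -/
theorem morreyNorm_mono (n : ℕ) (p : ℝ) {q : ℝ} (hq : 0 ≤ q) {u v : Eucl n → ℝ}
    (h : ∀ y, |u y| ≤ |v y|) : morreyNorm n p q u ≤ morreyNorm n p q v := by
  unfold morreyNorm
  gcongr (⨆ x, ⨆ r, ⨆ _, _ * (∫⁻ y in _, ENNReal.ofReal (?_ ^ q)) ^ (1 / q)) with x r _ y
  exact h y

/-- characterization of the star subspace. -/
theorem memStarMorrey_iff
    (n : ℕ) (hn : 1 ≤ n) (p q : ℝ) (hq : 1 ≤ q) (hqp : q ≤ p)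
    (f : Eucl n → ℝ) (hf : MemMorrey n p q f) :
    MemStarMorrey n p q f ↔
      Filter.Tendsto
        (fun R : ℝ => morreyNorm n p q (((ball (0 : Eucl n) R)ᶜ).indicator f))
        Filter.atTop (nhds 0) := by
  have hq0 : 0 ≤ q := zero_le_one.trans hq
  constructor
  · rintro ⟨-, H⟩
    rw [ENNReal.tendsto_nhds_zero]
    intro ε hε
    obtain ⟨δ, -, hδ0, hδ⟩ := ENNReal.lt_iff_exists_real_btwn.1 hε
    obtain ⟨g, -, hg, hfg⟩ := H δ (ENNReal.ofReal_pos.1 hδ0)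
    obtain ⟨R₀, hR₀⟩ := hg.isCompact.isBounded.subset_ball (0 : Eucl n)
    filter_upwards [Filter.eventually_ge_atTop R₀] with R hR
    refine (morreyNorm_mono n p hq0 fun y => ?_).trans (hfg.le.trans hδ.le)
    by_cases hy : y ∈ ball (0 : Eucl n) R
    · simp [Set.indicator_of_notMem (show y ∉ (ball (0 : Eucl n) R)ᶜ from fun h => h hy)]
    · have hgy : g y = 0 := image_eq_zero_of_notMem_tsupport
        fun h => hy (ball_subset_ball hR (hR₀ h))
      simp [Set.indicator_of_mem (show y ∈ (ball (0 : Eucl n) R)ᶜ from hy), hgy]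
  · intro H
    refine ⟨hf, fun ε hε => ?_⟩
    obtain ⟨R, hR⟩ := (H.eventually_lt_const (ENNReal.ofReal_pos.2 hε)).exists
    refine ⟨(ball (0 : Eucl n) R).indicator f,
      ⟨hf.1.indicator measurableSet_ball, lt_of_le_of_lt (morreyNorm_mono n p hq0 fun y => ?_) hf.2⟩,
      HasCompactSupport.intro (isCompact_closedBall (0 : Eucl n) R) fun y hy =>
        Set.indicator_of_notMem (fun h => hy (ball_subset_closedBall h)) f, ?_⟩
    · simpa only [Real.norm_eq_abs] using norm_indicator_le_norm_self f y
    · rwa [Set.indicator_compl] at hR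
end
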